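/- arXiv:2204.00516 — 3 statements merged into one kernel-verified Lean document; each statement's English description precedes it below -/
import Mathlib

section
/- The group O(Λ_ℚ) of isometries of the rational quadratic space Λ_ℚ is generated by the subgroup Γ together with the subgroup O(L_ℚ). -/
noncomputable section

open LinearMap (BilinForm)

variable {V : Type*} [AddCommGroup V] [Module ℚ V]

/-- The group `O(B)` of isometries of a bilinear form `B`. -/
def isomGroup (B : BilinForm ℚ V) : Subgroup (V ≃ₗ[ℚ] V) where
  carrier := {g | ∀ x y, B (g x) (g y) = B x y}
  one_mem' := fun _ _ => rfl
  mul_mem' := by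
    intro a b ha hb x y
    calc B ((a * b) x) ((a * b) y) = B (a (b x)) (a (b y)) := rfl
      _ = B (b x) (b y) := ha _ _
      _ = B x y := hb _ _
  inv_mem' := by
    intro a ha x y
    calc B (a⁻¹ x) (a⁻¹ y) = B (a (a⁻¹ x)) (a (a⁻¹ y)) := (ha _ _).symm
      _ = B x y := by
          show B (a (a.symm x)) (a (a.symm y)) = B x y
          rw [a.apply_symm_apply, a.apply_symm_apply]

/-- `P` is a 3-dimensional positive-definite subspace for `B`. -/
def IsPosDefThree (B : BilinForm ℚ V) (P : Submodule ℚ V) : Prop :=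
  Module.finrank ℚ P = 3 ∧ ∀ x ∈ P, x ≠ 0 → 0 < B x x

/-- `g` preserves the orientation of the positive cone of `B`: for some 3-dimensional
positive-definite subspace `P`, the composition of the restriction of `g` to `P` with the
`B`-orthogonal projection back onto `P` has positive determinant. -/
def OrientPos (B : BilinForm ℚ V) (g : V ≃ₗ[ℚ] V) : Prop :=
  ∃ P : Submodule ℚ V, IsPosDefThree B P ∧
    ∃ π : V →ₗ[ℚ] V, (∀ x, π x ∈ P) ∧ (∀ x, ∀ p ∈ P, B (x - π x) p = 0) ∧
      ∃ q : ↥P →ₗ[ℚ] ↥P, (∀ x : ↥P, (q x : V) = π (g (x : V))) ∧ 0 < LinearMap.det q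

/-- The dual lattice `L* = {x : (x, L) ⊆ ℤ}` of a lattice `L`. -/
def dualLattice (B : BilinForm ℚ V) (L : Submodule ℤ V) : Submodule ℤ V where
  carrier := {x | ∀ y ∈ L, ∃ n : ℤ, B x y = (n : ℚ)}
  zero_mem' := by
    intro y _
    exact ⟨0, by simp⟩
  add_mem' := by
    intro a b ha hb y hy
    obtain ⟨m, hm⟩ := ha y hy
    obtain ⟨n, hn⟩ := hb y hy
    refine ⟨m + n, ?_⟩
    rw [map_add, LinearMap.add_apply, hm, hn]
    push_cast
    ring
  smul_mem' := by
    intro c x hx y hy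
    obtain ⟨n, hn⟩ := hx y hy
    refine ⟨c * n, ?_⟩
    have h1 : ((c : ℚ)) • x = c • x := Int.cast_smul_eq_zsmul ℚ c x
    rw [← h1, map_smul, LinearMap.smul_apply, hn, smul_eq_mul]
    push_cast
    ring

/-- `g` maps the lattice `L` bijectively onto itself. -/
def PreservesLattice (L : Submodule ℤ V) (g : V ≃ₗ[ℚ] V) : Prop :=
  (∀ x ∈ L, g x ∈ L) ∧ ∀ x ∈ L, g.symm x ∈ L

/-- `g` acts on the discriminant group `L*/L` as `+1` or as `-1`. -/
def ActsAsPMOne (B : BilinForm ℚ V) (L : Submodule ℤ V) (g : V ≃ₗ[ℚ] V) : Prop :=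
  (∀ x ∈ dualLattice B L, g x - x ∈ L) ∨ ∀ x ∈ dualLattice B L, g x + x ∈ L

/-- Membership in the subgroup `Γ ⊆ O⁺(Λ)` of isometries preserving the lattice and acting
on the discriminant group as `±1`. -/
def InGamma (B : BilinForm ℚ V) (L : Submodule ℤ V) (g : V ≃ₗ[ℚ] V) : Prop :=
  g ∈ isomGroup B ∧ PreservesLattice L g ∧ OrientPos B g ∧ ActsAsPMOne B L g

/-- The bilinear form of `Λ_ℚ = L_ℚ ⊕ ℚδ` with `(δ, δ) = -2d`. -/
def prodForm (B : BilinForm ℚ V) (d : ℤ) : BilinForm ℚ (V × ℚ) :=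
  LinearMap.mk₂ ℚ (fun p q => B p.1 q.1 - (2 * (d : ℚ)) * (p.2 * q.2))
    (fun p p' q => by
      simp only [Prod.fst_add, Prod.snd_add, map_add, LinearMap.add_apply]
      ring)
    (fun c p q => by
      simp only [Prod.smul_fst, Prod.smul_snd, map_smul, LinearMap.smul_apply, smul_eq_mul]
      ring)
    (fun p q q' => by
      simp only [Prod.fst_add, Prod.snd_add, map_add, LinearMap.add_apply]
      ring)
    (fun p c q => by
      simp only [Prod.smul_fst, Prod.smul_snd, map_smul, LinearMap.smul_apply, smul_eq_mul]
      ring)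

/-- The lattice `ℤ ⊆ ℚ`, i.e. the ℤ-span of `1`. -/
def intLat : Submodule ℤ ℚ := Submodule.span ℤ {(1 : ℚ)}

/-- Membership in the subgroup `O(L_ℚ) ⊆ O(Λ_ℚ)`: isometries of `Λ_ℚ = L_ℚ ⊕ ℚδ` preserving
`L_ℚ` and fixing `δ`, i.e. extensions of isometries of `L_ℚ` by the identity on `δ`. -/
def InOLQ (B : BilinForm ℚ V) (d : ℤ) (g : (V × ℚ) ≃ₗ[ℚ] (V × ℚ)) : Prop :=
  g ∈ isomGroup (prodForm B d) ∧ (∀ x : V, (g (x, 0)).2 = 0) ∧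
    g ((0 : V), (1 : ℚ)) = ((0 : V), (1 : ℚ))

/-- `B` has signature `(3, s)`: an orthogonal direct sum decomposition into a positive-definite
subspace of dimension `3` and a negative-definite subspace of dimension `s`. -/
def HasSignatureThree (B : BilinForm ℚ V) (s : ℕ) : Prop :=
  ∃ P N : Submodule ℚ V, IsCompl P N ∧ (∀ x ∈ P, ∀ y ∈ N, B x y = 0) ∧
    Module.finrank ℚ P = 3 ∧ Module.finrank ℚ N = s ∧
    (∀ x ∈ P, x ≠ 0 → 0 < B x x) ∧ ∀ x ∈ N, x ≠ 0 → B x x < 0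

/-- `L` contains a sublattice isometric to `U ⊕ U ⊕ U`, where `U` is the hyperbolic plane with
isotropic basis `e, f` and `(e, f) = -1`. -/
def ContainsU3 (B : BilinForm ℚ V) (L : Submodule ℤ V) : Prop :=
  ∃ e f : Fin 3 → V, (∀ i, e i ∈ L) ∧ (∀ i, f i ∈ L) ∧
    (∀ i j, B (e i) (e j) = 0) ∧ (∀ i j, B (f i) (f j) = 0) ∧
    ∀ i j, B (e i) (f j) = if i = j then -1 else 0

/-- `l` is a primitive element of the lattice `L`: `l ∈ L`, `l ≠ 0` and `L/ℤl` is
torsion-free. -/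
def IsPrimitiveIn (L : Submodule ℤ V) (l : V) : Prop :=
  l ∈ L ∧ l ≠ 0 ∧ ∀ y ∈ L, ∀ n : ℤ, n ≠ 0 →
    n • y ∈ Submodule.span ℤ ({l} : Set V) → y ∈ Submodule.span ℤ ({l} : Set V)

/-- The reflection `ρ_u(x) = x - (2(u,x)/(u,u))·u` (as a plain function). -/
def reflFun (B : BilinForm ℚ V) (u : V) (x : V) : V :=
  x - (2 * B u x / B u u) • u

/-- The extension of `g` to `V × ℚ` by the identity on the second factor. -/
def extendById (g : V ≃ₗ[ℚ] V) : (V × ℚ) ≃ₗ[ℚ] (V × ℚ) :=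
  g.prodCongr (LinearEquiv.refl ℚ ℚ)

theorem prodForm_apply (B : BilinForm ℚ V) (d : ℤ) (p q : V × ℚ) :
    prodForm B d p q = B p.1 q.1 - (2 * (d : ℚ)) * (p.2 * q.2) := rfl

theorem extendById_apply (g : V ≃ₗ[ℚ] V) (v : V × ℚ) : extendById g v = (g v.1, v.2) := rfl

theorem inOLQ_extendById (B : BilinForm ℚ V) (d : ℤ) {g : V ≃ₗ[ℚ] V} (hg : g ∈ isomGroup B) :
    InOLQ B d (extendById g) := by
  refine ⟨fun x y => ?_, fun x => rfl, ?_⟩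
  · rw [prodForm_apply, prodForm_apply, extendById_apply, extendById_apply, hg x.1 y.1]
  · rw [extendById_apply, map_zero]

/-- The linear map underlying the Eichler transvection attached to `e ∈ V` and `δ = (0, 1)`. -/
def eichlerMap (B : BilinForm ℚ V) (d : ℤ) (e : V) : (V × ℚ) →ₗ[ℚ] (V × ℚ) where
  toFun v := (v.1 + (2 * d * v.2 + d * B v.1 e) • e, v.2 + B v.1 e)
  map_add' v w := by
    ext
    · simp only [Prod.fst_add, Prod.snd_add, map_add, LinearMap.add_apply]
      module
    · simp only [Prod.fst_add, Prod.snd_add, map_add, LinearMap.add_apply]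
      ring
  map_smul' c v := by
    ext
    · simp only [Prod.smul_fst, Prod.smul_snd, map_smul, LinearMap.smul_apply, smul_eq_mul,
        RingHom.id_apply]
      module
    · simp only [Prod.smul_fst, Prod.smul_snd, map_smul, LinearMap.smul_apply, smul_eq_mul,
        RingHom.id_apply]
      ring

theorem eichlerMap_apply (B : BilinForm ℚ V) (d : ℤ) (e : V) (v : V × ℚ) :
    eichlerMap B d e v = (v.1 + (2 * d * v.2 + d * B v.1 e) • e, v.2 + B v.1 e) := rfl

theorem eichlerMap_neg_apply (B : BilinForm ℚ V) (d : ℤ) {e : V} (he : B e e = 0) (v : V × ℚ) :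
    eichlerMap B d (-e) (eichlerMap B d e v) = v := by
  ext
  · simp only [eichlerMap_apply, map_add, map_neg, map_smul, LinearMap.add_apply,
      LinearMap.smul_apply, smul_eq_mul, he]
    module
  · simp only [eichlerMap_apply, map_add, map_neg, map_smul, LinearMap.add_apply,
      LinearMap.smul_apply, smul_eq_mul, he]
    ring

/-- The Eichler transvection of `V × ℚ` attached to an isotropic `e ∈ V` and `δ = (0, 1)`. -/
def eichler (B : BilinForm ℚ V) (d : ℤ) (e : V) (he : B e e = 0) :
    (V × ℚ) ≃ₗ[ℚ] (V × ℚ) :=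
  LinearEquiv.ofLinearMap (eichlerMap B d e) (eichlerMap B d (-e))
    (LinearMap.ext fun v => by
      have h := eichlerMap_neg_apply B d (e := -e) (by simp [he]) v
      rwa [neg_neg] at h)
    (LinearMap.ext fun v => eichlerMap_neg_apply B d he v)

theorem eichler_apply (B : BilinForm ℚ V) (d : ℤ) {e : V} (he : B e e = 0) (v : V × ℚ) :
    eichler B d e he v = (v.1 + (2 * d * v.2 + d * B v.1 e) • e, v.2 + B v.1 e) := rfl

theorem eichler_symm_apply (B : BilinForm ℚ V) (d : ℤ) {e : V} (he : B e e = 0) (v : V × ℚ) :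
    (eichler B d e he).symm v = eichlerMap B d (-e) v := rfl

theorem eichler_mem_isomGroup (B : BilinForm ℚ V) (d : ℤ) (hsymm : ∀ x y, B x y = B y x)
    {e : V} (he : B e e = 0) : eichler B d e he ∈ isomGroup (prodForm B d) := by
  intro x y
  simp only [prodForm_apply, eichler_apply, map_add, map_smul, LinearMap.add_apply,
    LinearMap.smul_apply, smul_eq_mul, he, hsymm e y.1]
  ring

theorem mem_intLat {a : ℚ} : a ∈ intLat ↔ ∃ n : ℤ, (n : ℚ) = a := by
  simp [intLat, Submodule.mem_span_singleton]

theorem int_smul_mem (L : Submodule ℤ V) {x : V} (hx : x ∈ L) (n : ℤ) : (n : ℚ) • x ∈ L := by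
  rw [Int.cast_smul_eq_zsmul]
  exact L.smul_mem n hx

theorem eichlerMap_sub_mem (B : BilinForm ℚ V) (L : Submodule ℤ V) (d : ℤ) {e : V} (heL : e ∈ L)
    {v : V × ℚ} (h₁ : ∃ m : ℤ, B v.1 e = m) (h₂ : ∃ n : ℤ, 2 * d * v.2 = n) :
    eichlerMap B d e v - v ∈ L.prod intLat := by
  obtain ⟨m, hm⟩ := h₁
  obtain ⟨n, hn⟩ := h₂
  rw [eichlerMap_apply, hm, hn]
  refine ⟨?_, mem_intLat.2 ⟨m, by simp⟩⟩
  have h := int_smul_mem L heL (n + d * m)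
  push_cast at h
  simpa using h

theorem eichlerMap_mem (B : BilinForm ℚ V) (L : Submodule ℤ V) (d : ℤ)
    (hint : ∀ x ∈ L, ∀ y ∈ L, ∃ n : ℤ, B x y = (n : ℚ)) {e : V} (heL : e ∈ L)
    {v : V × ℚ} (hv : v ∈ L.prod intLat) : eichlerMap B d e v ∈ L.prod intLat := by
  obtain ⟨n, hn⟩ := mem_intLat.1 hv.2
  have h := eichlerMap_sub_mem B L d heL (hint _ hv.1 _ heL)
    ⟨2 * d * n, by rw [← hn]; push_cast; ring⟩
  simpa using add_mem h hv

theorem eichler_orientPos [FiniteDimensional ℚ V] (B : BilinForm ℚ V) {d : ℤ} (hd : 0 < d)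
    (hsymm : ∀ x y, B x y = B y x) {s : ℕ} (hsig : HasSignatureThree B s)
    {e : V} (he : B e e = 0) : OrientPos (prodForm B d) (eichler B d e he) := by
  obtain ⟨P, N, hPN, horth, hP3, -, hpos, -⟩ := hsig
  let pr : V →ₗ[ℚ] V := P.projection N hPN
  have hprP : ∀ x, pr x ∈ P := fun x => Submodule.projection_apply_mem hPN x
  have hprB : ∀ x, ∀ p ∈ P, B (x - pr x) p = 0 := by
    intro x p hp
    rw [hsymm]
    refine horth p hp _ ?_
    rw [← Submodule.projection_apply_eq_zero_iff hPN, map_sub, sub_eq_zero]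
    exact (Submodule.projection_apply_left hPN ⟨pr x, hprP x⟩).symm
  have hprid : ∀ x ∈ P, pr x = x := fun x hx => Submodule.projection_apply_left hPN ⟨x, hx⟩
  refine ⟨P.map (LinearMap.inl ℚ V ℚ), ⟨?_, ?_⟩,
    LinearMap.inl ℚ V ℚ ∘ₗ pr ∘ₗ LinearMap.fst ℚ V ℚ, ?_, ?_, ?_⟩
  · rw [← hP3]
    exact (Submodule.equivMapOfInjective _ LinearMap.inl_injective P).finrank_eq.symm
  · rintro _ ⟨x, hx, rfl⟩ hne
    have hx0 : x ≠ 0 := by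
      rintro rfl
      exact hne (map_zero _)
    simpa [prodForm_apply] using hpos x hx hx0
  · exact fun x => Submodule.mem_map_of_mem (hprP x.1)
  · rintro x _ ⟨p, hp, rfl⟩
    simpa [prodForm_apply] using hprB x.1 p hp
  · let w : ↥(P.map (LinearMap.inl ℚ V ℚ)) :=
      ⟨LinearMap.inl ℚ V ℚ (pr e), Submodule.mem_map_of_mem (hprP e)⟩
    let f : Module.Dual ℚ ↥(P.map (LinearMap.inl ℚ V ℚ)) :=
      ((d : ℚ) • prodForm B d w) ∘ₗ Submodule.subtype _
    refine ⟨LinearMap.transvection f w, ?_, ?_⟩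
    · rintro ⟨_, x, hx, rfl⟩
      have h1 : B (pr e) x = B x e := by
        have := hprB e x hx
        rw [map_sub, LinearMap.sub_apply, sub_eq_zero] at this
        rw [← this, hsymm]
      ext
      · simp [LinearMap.transvection.apply, f, w, eichler_apply, prodForm_apply, h1, hprid x hx]
      · simp [LinearMap.transvection.apply, f, w, eichler_apply, prodForm_apply]
    · rw [LinearMap.transvection.det]
      have hw : 0 ≤ B (pr e) (pr e) := by
        by_cases h0 : pr e = 0
        · simp [h0]
        · exact (hpos _ (hprP e) h0).le
      have hd' : (0 : ℚ) < d := by exact_mod_cast hd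
      have hf : f w = d * B (pr e) (pr e) := by
        simp [f, w, prodForm_apply]
      rw [hf]
      positivity

theorem eichler_inGamma [FiniteDimensional ℚ V] (B : BilinForm ℚ V) (L : Submodule ℤ V) {d : ℤ}
    (hd : 0 < d) (hsymm : ∀ x y, B x y = B y x)
    (hint : ∀ x ∈ L, ∀ y ∈ L, ∃ n : ℤ, B x y = (n : ℚ)) {s : ℕ} (hsig : HasSignatureThree B s)
    {e : V} (heL : e ∈ L) (he : B e e = 0) :
    InGamma (prodForm B d) (L.prod intLat) (eichler B d e he) := by
  refine ⟨eichler_mem_isomGroup B d hsymm he, ⟨fun x hx => ?_, fun x hx => ?_⟩,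
    eichler_orientPos B hd hsymm hsig he, Or.inl fun x hx => ?_⟩
  · exact eichlerMap_mem B L d hint heL hx
  · rw [eichler_symm_apply]
    exact eichlerMap_mem B L d hint (neg_mem heL) hx
  · refine eichlerMap_sub_mem B L d heL ?_ ?_
    · obtain ⟨m, hm⟩ := hx (e, 0) ⟨heL, zero_mem _⟩
      exact ⟨m, by simpa [prodForm_apply] using hm⟩
    · obtain ⟨m, hm⟩ := hx (0, 1) ⟨zero_mem _, mem_intLat.2 ⟨1, by simp⟩⟩
      refine ⟨-m, ?_⟩
      simp [prodForm_apply] at hm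
      push_cast
      linarith

theorem exists_isom_of_sub_ne_zero (B : BilinForm ℚ V) (hsymm : ∀ x y, B x y = B y x)
    {x y : V} (hxy : B x x = B y y) (hne : B (x - y) (x - y) ≠ 0) :
    ∃ g ∈ isomGroup B, g x = y := by
  set u := x - y with hu
  let f : Module.Dual ℚ V := (2 / B u u) • B u
  have hf : f u = 2 := by
    simp only [f, LinearMap.smul_apply, smul_eq_mul]
    field_simp
  refine ⟨Module.reflection hf, fun a b => ?_, ?_⟩
  · simp only [Module.reflection_apply, f, LinearMap.smul_apply, smul_eq_mul, map_sub, map_smul,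
      LinearMap.sub_apply, hsymm a u]
    field_simp
    ring
  · have h1 : B u u = 2 * B u x := by
      simp only [hu, map_sub, LinearMap.sub_apply, hsymm x y]
      linarith
    have h2 : f x = 1 := by
      simp only [f, LinearMap.smul_apply, smul_eq_mul]
      rw [div_mul_eq_mul_div, ← h1, div_self hne]
    rw [Module.reflection_apply, h2, one_smul, hu, sub_sub_cancel]

theorem exists_isom_of_eq_norm (B : BilinForm ℚ V) (hsymm : ∀ x y, B x y = B y x)
    {x y : V} (hxy : B x x = B y y) (hx : B x x ≠ 0) : ∃ g ∈ isomGroup B, g x = y := by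
  by_cases h : B (x - y) (x - y) = 0
  · obtain ⟨g, hg, hgx⟩ := exists_isom_of_sub_ne_zero B hsymm (x := x) (y := -y)
      (by simpa using hxy) (by
        intro h'
        apply hx
        simp only [map_sub, map_neg, LinearMap.sub_apply, LinearMap.neg_apply] at h h'
        linarith)
    refine ⟨LinearEquiv.neg ℚ * g, mul_mem (fun a b => ?_) hg, ?_⟩
    · simp
    · simp [hgx]
  · exact exists_isom_of_sub_ne_zero B hsymm hxy h

theorem exists_int_smul_mem (L : Submodule ℤ V) (hfull : Submodule.span ℚ (L : Set V) = ⊤)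
    (x : V) : ∃ n : ℤ, n ≠ 0 ∧ (n : ℚ) • x ∈ L := by
  have hx : x ∈ Submodule.span ℚ (L : Set V) := hfull ▸ Submodule.mem_top
  induction hx using Submodule.span_induction with
  | mem x hx => exact ⟨1, one_ne_zero, by simpa using hx⟩
  | zero => exact ⟨1, one_ne_zero, by simp⟩
  | add x y _ _ hx hy =>
    obtain ⟨m, hm, hmx⟩ := hx
    obtain ⟨n, hn, hny⟩ := hy
    refine ⟨m * n, mul_ne_zero hm hn, ?_⟩
    have h := add_mem (int_smul_mem L hmx n) (int_smul_mem L hny m)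
    rw [smul_smul, smul_smul] at h
    rw [smul_add]
    push_cast
    rwa [mul_comm (n : ℚ)] at h
  | smul c x _ hx =>
    obtain ⟨m, hm, hmx⟩ := hx
    refine ⟨m * c.den, mul_ne_zero hm (by exact_mod_cast c.den_ne_zero), ?_⟩
    have h := int_smul_mem L hmx c.num
    rw [smul_smul] at h
    rw [smul_smul]
    push_cast
    rwa [mul_assoc, Rat.den_mul_eq_num, mul_comm]

theorem exists_apply_ne_zero (B : BilinForm ℚ V) {s : ℕ} (hsig : HasSignatureThree B s)
    (hsymm : ∀ x y, B x y = B y x) {x : V} (hx : x ≠ 0) : ∃ w, B x w ≠ 0 := by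
  obtain ⟨P, N, hPN, horth, -, -, hpos, hneg⟩ := hsig
  by_contra! h
  obtain ⟨p, hp, n, hn, rfl⟩ := Submodule.mem_sup.1 (hPN.sup_eq_top ▸ Submodule.mem_top (x := x))
  have h1 := h p
  have h2 := h n
  rw [map_add, LinearMap.add_apply, hsymm n p, horth p hp n hn, add_zero] at h1
  rw [map_add, LinearMap.add_apply, horth p hp n hn, zero_add] at h2
  have hp0 : p = 0 := by
    by_contra h0
    exact (hpos p hp h0).ne' h1
  have hn0 : n = 0 := by
    by_contra h0
    exact (hneg n hn h0).ne h2
  exact hx (by rw [hp0, hn0, add_zero])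

theorem exists_isotropic_apply_ne_zero (B : BilinForm ℚ V) (L : Submodule ℤ V)
    (hsymm : ∀ x y, B x y = B y x) (hfull : Submodule.span ℚ (L : Set V) = ⊤)
    {s : ℕ} (hsig : HasSignatureThree B s) {x : V} (hx : x ≠ 0) (hxx : B x x = 0) :
    ∃ e ∈ L, B e e = 0 ∧ B x e ≠ 0 := by
  obtain ⟨w, hw⟩ := exists_apply_ne_zero B hsig hsymm hx
  obtain ⟨n, hn, hnL⟩ := exists_int_smul_mem L hfull (w - (B w w / (2 * B x w)) • x)
  refine ⟨_, hnL, ?_, ?_⟩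
  · simp only [map_sub, map_smul, LinearMap.sub_apply, LinearMap.smul_apply, smul_eq_mul, hxx,
      hsymm w x]
    field_simp
    ring
  · simp only [map_sub, map_smul, smul_eq_mul, hxx, mul_zero, sub_zero]
    exact mul_ne_zero (by exact_mod_cast hn) hw

section Transitivity

variable {B : BilinForm ℚ V} {L : Submodule ℤ V} {d : ℤ}
  {G : Subgroup ((V × ℚ) ≃ₗ[ℚ] (V × ℚ))}

theorem exists_snd_eq_zero_of_fst_anisotropic (hsymm : ∀ x y, B x y = B y x)
    (hΓ : ∀ e ∈ L, ∀ he : B e e = 0, eichler B d e he ∈ G)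
    (hO : ∀ g ∈ isomGroup B, extendById g ∈ G) (hU3 : ContainsU3 B L)
    (x : V) (a : ℚ) (hx : B x x ≠ 0) : ∃ g ∈ G, (g (x, a)).2 = 0 := by
  obtain ⟨e, f, heL, -, hee, hff, hef⟩ := hU3
  by_cases ha : a = 0
  · exact ⟨1, one_mem _, ha⟩
  have hef0 : B (e 0) (f 0) = -1 := by simp [hef]
  have hfe0 : B (f 0) (e 0) = -1 := by rw [hsymm, hef0]
  obtain ⟨g, hg, hgx⟩ := exists_isom_of_eq_norm B hsymm (x := x)
    (y := (-(B x x) / (2 * a)) • e 0 + a • f 0) (by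
      simp only [map_add, map_smul, LinearMap.add_apply, LinearMap.smul_apply, smul_eq_mul,
        hee, hff, hef0, hfe0]
      field_simp
      ring) hx
  refine ⟨eichler B d (e 0) (hee 0 0) * extendById g, mul_mem (hΓ _ (heL 0) _) (hO g hg), ?_⟩
  rw [LinearEquiv.mul_apply, extendById_apply, hgx, eichler_apply]
  simp [hee, hfe0]

theorem exists_snd_eq_zero_of_fst_ne_zero (hsymm : ∀ x y, B x y = B y x)
    (hfull : Submodule.span ℚ (L : Set V) = ⊤) {s : ℕ} (hsig : HasSignatureThree B s)
    (hd : 0 < d)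
    (hΓ : ∀ e ∈ L, ∀ he : B e e = 0, eichler B d e he ∈ G)
    (hO : ∀ g ∈ isomGroup B, extendById g ∈ G) (hU3 : ContainsU3 B L)
    (x : V) (a : ℚ) (hx : x ≠ 0) (hxa : B x x = 2 * d * (a ^ 2 - 1)) :
    ∃ g ∈ G, (g (x, a)).2 = 0 := by
  have hd' : (d : ℚ) ≠ 0 := by exact_mod_cast hd.ne'
  by_cases hxx : B x x = 0
  · have ha : a ^ 2 = 1 := by
      rw [hxx, eq_comm, mul_eq_zero, or_iff_right (mul_ne_zero two_ne_zero hd')] at hxa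
      linarith
    obtain ⟨e, heL, he, hxe⟩ := exists_isotropic_apply_ne_zero B L hsymm hfull hsig hx hxx
    obtain ⟨e, heL, he, hxe, hxe'⟩ : ∃ e ∈ L, B e e = 0 ∧ B x e ≠ 0 ∧ B x e + 2 * a ≠ 0 := by
      by_cases h : B x e + 2 * a = 0
      · refine ⟨-e, neg_mem heL, by simpa using he, by simpa using hxe, fun h' => hxe ?_⟩
        rw [map_neg] at h'
        linarith
      · exact ⟨e, heL, he, hxe, h⟩
    let y := x + (2 * d * a + d * B x e) • e
    have hy : B y y ≠ 0 := by
      have : B y y = 2 * d * (B x e * (B x e + 2 * a)) := by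
        simp only [y, map_add, map_smul, LinearMap.add_apply, LinearMap.smul_apply, smul_eq_mul,
          hxx, he, hsymm e x]
        ring
      rw [this]
      exact mul_ne_zero (mul_ne_zero two_ne_zero hd') (mul_ne_zero hxe hxe')
    obtain ⟨g, hg, hgy⟩ :=
      exists_snd_eq_zero_of_fst_anisotropic hsymm hΓ hO hU3 y (a + B x e) hy
    exact ⟨g * eichler B d e he, mul_mem hg (hΓ e heL he), hgy⟩
  · exact exists_snd_eq_zero_of_fst_anisotropic hsymm hΓ hO hU3 x a hxx

theorem exists_snd_eq_zero (hsymm : ∀ x y, B x y = B y x)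
    (hfull : Submodule.span ℚ (L : Set V) = ⊤) {s : ℕ} (hsig : HasSignatureThree B s)
    (hd : 0 < d)
    (hΓ : ∀ e ∈ L, ∀ he : B e e = 0, eichler B d e he ∈ G)
    (hO : ∀ g ∈ isomGroup B, extendById g ∈ G) (hU3 : ContainsU3 B L)
    (v : V × ℚ) (hv : prodForm B d v v = -2 * d) :
    ∃ g ∈ G, (g v).2 = 0 := by
  obtain ⟨x, a⟩ := v
  have hxa : B x x = 2 * d * (a ^ 2 - 1) := by
    simp only [prodForm_apply] at hv
    linarith
  by_cases hx : x = 0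
  · subst hx
    have hd' : (d : ℚ) ≠ 0 := by exact_mod_cast hd.ne'
    have ha : a ^ 2 = 1 := by
      rw [map_zero, eq_comm, mul_eq_zero,
        or_iff_right (mul_ne_zero two_ne_zero hd')] at hxa
      linarith
    have ha0 : a ≠ 0 := by
      rintro rfl
      norm_num at ha
    obtain ⟨e, f, heL, -, hee, -, hef⟩ := id hU3
    have he0 : e 0 ≠ 0 := by
      intro h
      have := hef 0 0
      simp [h] at this
    obtain ⟨g, hg, hgy⟩ := exists_snd_eq_zero_of_fst_ne_zero hsymm hfull hsig hd hΓ hO hU3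
      ((2 * d * a) • e 0) a (smul_ne_zero (mul_ne_zero (mul_ne_zero two_ne_zero hd') ha0) he0)
      (by simp [hee, ha])
    refine ⟨g * eichler B d (e 0) (hee 0 0), mul_mem hg (hΓ _ (heL 0) _), ?_⟩
    rw [LinearEquiv.mul_apply, eichler_apply]
    simpa using hgy
  · exact exists_snd_eq_zero_of_fst_ne_zero hsymm hfull hsig hd hΓ hO hU3 x a hx hxa

theorem exists_apply_eq_of_norm_eq (hsymm : ∀ x y, B x y = B y x)
    (hfull : Submodule.span ℚ (L : Set V) = ⊤) {s : ℕ} (hsig : HasSignatureThree B s)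
    (hd : 0 < d) (hG : G ≤ isomGroup (prodForm B d))
    (hΓ : ∀ e ∈ L, ∀ he : B e e = 0, eichler B d e he ∈ G)
    (hO : ∀ g ∈ isomGroup B, extendById g ∈ G) (hU3 : ContainsU3 B L)
    {v w : V × ℚ} (hv : prodForm B d v v = -2 * d) (hw : prodForm B d w w = -2 * d) :
    ∃ g ∈ G, g v = w := by
  have hd' : (d : ℚ) ≠ 0 := by exact_mod_cast hd.ne'
  obtain ⟨g, hg, hgv⟩ := exists_snd_eq_zero hsymm hfull hsig hd hΓ hO hU3 v hv
  obtain ⟨h, hh, hhw⟩ := exists_snd_eq_zero hsymm hfull hsig hd hΓ hO hU3 w hw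
  have h1 : B (g v).1 (g v).1 = -2 * d := by
    rw [← hv, ← hG hg v v, prodForm_apply, hgv]
    ring
  have h2 : B (h w).1 (h w).1 = -2 * d := by
    rw [← hw, ← hG hh w w, prodForm_apply, hhw]
    ring
  obtain ⟨k, hk, hkv⟩ := exists_isom_of_eq_norm B hsymm (h1.trans h2.symm)
    (by rw [h1]; exact mul_ne_zero (by norm_num) hd')
  refine ⟨h⁻¹ * (extendById k * g), mul_mem (inv_mem hh) (mul_mem (hO k hk) hg), ?_⟩
  have h3 : extendById k (g v) = h w := by
    rw [extendById_apply, hkv, hgv, ← hhw]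
  rw [LinearEquiv.mul_apply, LinearEquiv.mul_apply, h3]
  exact h.symm_apply_apply w

end Transitivity

theorem inOLQ_of_apply_eq (B : BilinForm ℚ V) {d : ℤ} (hd : 0 < d)
    {g : (V × ℚ) ≃ₗ[ℚ] (V × ℚ)} (hg : g ∈ isomGroup (prodForm B d))
    (hgδ : g ((0 : V), (1 : ℚ)) = ((0 : V), (1 : ℚ))) : InOLQ B d g := by
  refine ⟨hg, fun x => ?_, hgδ⟩
  have h := hg (x, 0) (0, 1)
  rw [hgδ] at h
  simp only [prodForm_apply, map_zero] at h
  have hd' : (d : ℚ) ≠ 0 := by exact_mod_cast hd.ne'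
  simpa [hd'] using h

/-- `O(Λ_ℚ)` is generated by the subgroup `Γ` together with the subgroup
`O(L_ℚ)`. -/
theorem statement0
    {V : Type*} [AddCommGroup V] [Module ℚ V] [FiniteDimensional ℚ V]
    (B : BilinForm ℚ V) (L : Submodule ℤ V) (d : ℤ)
    (hsymm : ∀ x y, B x y = B y x)
    (hfull : Submodule.span ℚ (L : Set V) = ⊤)
    (hfg : L.FG)
    (hint : ∀ x ∈ L, ∀ y ∈ L, ∃ n : ℤ, B x y = (n : ℚ))
    (heven : ∀ x ∈ L, ∃ n : ℤ, B x x = 2 * (n : ℚ))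
    (hunimod : dualLattice B L = L)
    (sminus : ℕ) (hs : 3 ≤ sminus) (hsig : HasSignatureThree B sminus)
    (hU3 : ContainsU3 B L)
    (hd : 0 < d) :
    Subgroup.closure {g : (V × ℚ) ≃ₗ[ℚ] (V × ℚ) |
        InGamma (prodForm B d) (L.prod intLat) g ∨ InOLQ B d g}
      = isomGroup (prodForm B d) := by
  set S : Set ((V × ℚ) ≃ₗ[ℚ] (V × ℚ)) :=
    {g | InGamma (prodForm B d) (L.prod intLat) g ∨ InOLQ B d g}
  have hS : Subgroup.closure S ≤ isomGroup (prodForm B d) := by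
    rw [Subgroup.closure_le]
    rintro g (hg | hg)
    · exact hg.1
    · exact hg.1
  refine le_antisymm hS fun g hg => ?_
  have hδ : prodForm B d ((0 : V), (1 : ℚ)) ((0 : V), (1 : ℚ)) = -2 * d := by
    simp [prodForm_apply]
  obtain ⟨h, hh, hhδ⟩ := exists_apply_eq_of_norm_eq (G := Subgroup.closure S) hsymm hfull hsig hd
    hS (fun e heL he => Subgroup.subset_closure
      (Or.inl (eichler_inGamma B L hd hsymm hint hsig heL he)))
    (fun g hg => Subgroup.subset_closure (Or.inr (inOLQ_extendById B d hg)))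
    hU3 ((hg _ _).trans hδ) hδ
  have hhg : h * g ∈ Subgroup.closure S :=
    Subgroup.subset_closure (Or.inr (inOLQ_of_apply_eq B hd (mul_mem (hS hh) hg) hhδ))
  exact (Subgroup.mul_mem_cancel_left _ hh).1 hhg
end
end

section
/- The group O(L_ℚ) of isometries of L_ℚ := L ⊗ ℚ is generated by O(L) (the isometries of L_ℚ preserving the lattice L) together with the reflections ρ_u for elements u ∈ L satisfying (u,u) > 0. -/
noncomputable section

open LinearMap (BilinForm)

variable {V : Type*} [AddCommGroup V] [Module ℚ V]

/-- The reflection in an anisotropic vector `u`, as a linear equivalence. -/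
def anisotropicReflection (B : BilinForm ℚ V) (u : V) (hu : B u u ≠ 0) : V ≃ₗ[ℚ] V :=
  Module.reflection (x := u) (f := (2 / B u u) • B u) (by
    rw [LinearMap.smul_apply, smul_eq_mul, div_mul_cancel₀ _ hu])

lemma anisotropicReflection_apply (B : BilinForm ℚ V) (u : V) (hu : B u u ≠ 0) (x : V) :
    anisotropicReflection B u hu x = x - (2 * B u x / B u u) • u := by
  rw [anisotropicReflection, Module.reflection_apply, LinearMap.smul_apply, smul_eq_mul,
    div_mul_eq_mul_div]

lemma anisotropicReflection_mem_isomGroup {B : BilinForm ℚ V} (hsymm : ∀ x y, B x y = B y x)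
    (u : V) (hu : B u u ≠ 0) : anisotropicReflection B u hu ∈ isomGroup B := by
  intro x y
  simp only [anisotropicReflection_apply, map_sub, map_smul, LinearMap.sub_apply,
    LinearMap.smul_apply, smul_eq_mul]
  rw [hsymm x u]
  field_simp
  ring

lemma anisotropicReflection_of_orthogonal {B : BilinForm ℚ V} (u : V) (hu : B u u ≠ 0) {x : V}
    (hx : B u x = 0) : anisotropicReflection B u hu x = x := by
  rw [anisotropicReflection_apply, hx]
  simp

lemma anisotropicReflection_self (B : BilinForm ℚ V) (u : V) (hu : B u u ≠ 0) :
    anisotropicReflection B u hu u = -u := by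
  rw [anisotropicReflection_apply, mul_div_assoc, div_self hu, mul_one, two_smul]
  abel

/-- Reflection in the difference of two vectors of equal norm exchanges them. -/
lemma anisotropicReflection_sub {B : BilinForm ℚ V} (hsymm : ∀ x y, B x y = B y x) {x y : V}
    (hxy : B x x = B y y) (hu : B (x - y) (x - y) ≠ 0) :
    anisotropicReflection B (x - y) hu x = y := by
  have h : 2 * B (x - y) x = B (x - y) (x - y) := by
    simp only [map_sub, LinearMap.sub_apply, hsymm y x]
    linarith
  rw [anisotropicReflection_apply, h, div_self hu, one_smul, sub_sub_cancel]

/-- An isometry conjugates the reflection in `u` to the reflection in the image of `u`. -/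
lemma anisotropicReflection_mem_of_map {B : BilinForm ℚ V} (H : Subgroup (V ≃ₗ[ℚ] V))
    {g : V ≃ₗ[ℚ] V} (hg : g ∈ H) (hgB : g ∈ isomGroup B) {u w : V} (hgu : g u = w)
    (hu : B u u ≠ 0) (hw : B w w ≠ 0) (h : anisotropicReflection B w hw ∈ H) :
    anisotropicReflection B u hu ∈ H := by
  have key : anisotropicReflection B u hu = g⁻¹ * anisotropicReflection B w hw * g := by
    subst hgu
    ext x
    show _ = g.symm (anisotropicReflection B (g u) hw (g x))
    rw [LinearEquiv.eq_symm_apply, anisotropicReflection_apply, anisotropicReflection_apply,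
      hgB u x, hgB u u, map_sub, map_smul]
  rw [key]
  exact H.mul_mem (H.mul_mem (H.inv_mem hg) h) hg

/-- A weak form of the Cartan–Dieudonné theorem: reflections generate the isometry group. -/
lemma isomGroup_le_of_anisotropicReflection_mem [FiniteDimensional ℚ V] {B : BilinForm ℚ V}
    (hsymm : ∀ x y, B x y = B y x) (hnondeg : ∀ x, (∀ y, B x y = 0) → x = 0)
    (H : Subgroup (V ≃ₗ[ℚ] V)) (hH : ∀ u (hu : B u u ≠ 0), anisotropicReflection B u hu ∈ H) :
    isomGroup B ≤ H := by
  obtain ⟨v, hv⟩ := LinearMap.BilinForm.exists_orthogonal_basis (B := B) ⟨hsymm⟩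
  have horth : ∀ i j, i ≠ j → B (v i) (v j) = 0 := fun i j hij => hv hij
  have hne : ∀ i, B (v i) (v i) ≠ 0 := by
    intro i hi
    refine v.ne_zero i (hnondeg _ fun y => ?_)
    have : B (v i) = 0 := v.ext fun j => by
      by_cases hij : i = j
      · rw [← hij, hi, LinearMap.zero_apply]
      · rw [horth i j hij, LinearMap.zero_apply]
    rw [this, LinearMap.zero_apply]
  suffices h : ∀ k : ℕ, ∀ g ∈ isomGroup B, ∃ h ∈ H, h ∈ isomGroup B ∧
      ∀ i, i.val < k → h (g (v i)) = v i by
    intro g hg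
    obtain ⟨h, hh, -, hfix⟩ := h _ g hg
    have h1 : h * g = 1 := by
      refine LinearEquiv.toLinearMap_injective (v.ext fun i => ?_)
      exact hfix i i.isLt
    rw [eq_inv_of_mul_eq_one_right h1]
    exact H.inv_mem hh
  intro k g hg
  induction k with
  | zero => exact ⟨1, H.one_mem, (isomGroup B).one_mem, fun i hi => absurd hi (Nat.not_lt_zero _)⟩
  | succ k ih =>
    obtain ⟨h, hh, hhB, hfix⟩ := ih
    by_cases hk : k < Module.finrank ℚ V
    swap
    · exact ⟨h, hh, hhB, fun i _ => hfix i (by omega)⟩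
    set x := v ⟨k, hk⟩ with hx
    set y := h (g x) with hy
    have hyy : B x x = B y y := by rw [hy, hhB, hg]
    have hx0 : ∀ i : Fin _, i.val < k → B x (v i) = 0 := fun i hi =>
      horth _ _ fun he => by rw [← he] at hi; exact lt_irrefl _ hi
    have hy0 : ∀ i : Fin _, i.val < k → B y (v i) = 0 := fun i hi => by
      rw [← hfix i hi, hy, hhB, hg, hx0 i hi]
    have hxne : B x x ≠ 0 := hne _
    obtain ⟨r, hr, hrB, hry, hrfix⟩ : ∃ r ∈ H, r ∈ isomGroup B ∧ r y = x ∧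
        ∀ i : Fin _, i.val < k → r (v i) = v i := by
      by_cases hd : B (y - x) (y - x) = 0
      · have hs : B (y - -x) (y - -x) ≠ 0 := by
          intro hs
          apply hxne
          simp only [map_sub, map_neg, LinearMap.sub_apply, LinearMap.neg_apply] at hd hs
          linarith
        have hxx : B y y = B (-x) (-x) := by simp [hyy]
        refine ⟨anisotropicReflection B x hxne * anisotropicReflection B (y - -x) hs,
          H.mul_mem (hH _ _) (hH _ _), (isomGroup B).mul_mem
            (anisotropicReflection_mem_isomGroup hsymm _ _)
            (anisotropicReflection_mem_isomGroup hsymm _ _), ?_, fun i hi => ?_⟩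
        · rw [LinearEquiv.mul_apply, anisotropicReflection_sub hsymm hxx, map_neg,
            anisotropicReflection_self, neg_neg]
        · rw [LinearEquiv.mul_apply, anisotropicReflection_of_orthogonal (y - -x) hs (by
            simp [hx0 i hi, hy0 i hi]), anisotropicReflection_of_orthogonal x hxne (hx0 i hi)]
      · refine ⟨anisotropicReflection B (y - x) hd, hH _ _,
          anisotropicReflection_mem_isomGroup hsymm _ _,
          anisotropicReflection_sub hsymm hyy.symm hd, fun i hi => ?_⟩
        exact anisotropicReflection_of_orthogonal _ _ (by simp [hx0 i hi, hy0 i hi])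
    refine ⟨r * h, H.mul_mem hr hh, (isomGroup B).mul_mem hrB hhB, fun i hi => ?_⟩
    rw [LinearEquiv.mul_apply]
    rcases Nat.lt_succ_iff_lt_or_eq.mp hi with hi | hi
    · rw [hfix i hi, hrfix i hi]
    · obtain rfl : i = ⟨k, hk⟩ := Fin.ext hi
      exact hry

/-- A form of signature `(3, s)` is nondegenerate. -/
lemma HasSignatureThree.eq_zero_of_forall {B : BilinForm ℚ V} {s : ℕ}
    (hsymm : ∀ x y, B x y = B y x) (hsig : HasSignatureThree B s) (x : V)
    (hx : ∀ y, B x y = 0) : x = 0 := by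
  obtain ⟨P, N, hPN, horth, -, -, hP, hN⟩ := hsig
  obtain ⟨p, hp, n, hn, rfl⟩ : ∃ p ∈ P, ∃ n ∈ N, p + n = x :=
    Submodule.mem_sup.mp (hPN.sup_eq_top ▸ Submodule.mem_top)
  have hpn := horth p hp n hn
  have h1 := hx p
  have h2 := hx n
  rw [map_add, LinearMap.add_apply] at h1 h2
  rw [hsymm n p, hpn, add_zero] at h1
  rw [hpn, zero_add] at h2
  have hp0 : p = 0 := by_contra fun h => (hP p hp h).ne' h1
  have hn0 : n = 0 := by_contra fun h => (hN n hn h).ne h2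
  rw [hp0, hn0, add_zero]

/-- A rational multiple of every vector of the rational span of `L` lies in `L`. -/
lemma exists_ne_zero_smul_mem_of_span_eq_top {L : Submodule ℤ V}
    (hfull : Submodule.span ℚ (L : Set V) = ⊤) (x : V) : ∃ n : ℤ, n ≠ 0 ∧ n • x ∈ L := by
  have hx : x ∈ Submodule.span ℚ (L : Set V) := hfull ▸ Submodule.mem_top
  induction hx using Submodule.span_induction with
  | mem x hx => exact ⟨1, one_ne_zero, by rwa [one_smul]⟩
  | zero => exact ⟨1, one_ne_zero, by simp⟩
  | add x y _ _ hx hy =>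
    obtain ⟨m, hm, hmx⟩ := hx
    obtain ⟨n, hn, hny⟩ := hy
    refine ⟨m * n, mul_ne_zero hm hn, ?_⟩
    rw [smul_add]
    refine L.add_mem ?_ ?_
    · rw [mul_comm, mul_smul]
      exact L.smul_mem n hmx
    · rw [mul_smul]
      exact L.smul_mem m hny
  | smul q x _ hx =>
    obtain ⟨n, hn, hnx⟩ := hx
    refine ⟨q.den * n, mul_ne_zero (by exact_mod_cast q.den_nz) hn, ?_⟩
    have : ((q.den : ℤ) * n) • q • x = q.num • n • x := by
      simp only [← Int.cast_smul_eq_zsmul ℚ, smul_smul]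
      congr 1
      push_cast
      have := Rat.den_mul_eq_num q
      linear_combination (n : ℚ) * this
    rw [this]
    exact L.smul_mem _ hnx

lemma exists_ne_zero_mul_add_div_lt {m a b : ℚ} (ha : a ≠ 0) :
    ∃ s : ℚ, s ≠ 0 ∧ s * a + m / s * b < -(2 * m) := by
  set t := (|2 * m| + |m * b / a|) / a ^ 2 + 1 with ht
  have ht1 : 1 ≤ t := le_add_of_nonneg_left (by positivity)
  have hta : |2 * m| + |m * b / a| < t * a ^ 2 := by
    have ha2 : 0 < a ^ 2 := by positivity
    rw [ht, add_mul, div_mul_cancel₀ _ ha2.ne']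
    linarith
  refine ⟨-(t * a), neg_ne_zero.mpr (mul_ne_zero (by linarith) ha), ?_⟩
  have hrw : -(t * a) * a + m / -(t * a) * b = -(t * a ^ 2) - m * b / a / t := by
    have : t ≠ 0 := by linarith
    field_simp
    ring
  have habs : |m * b / a / t| ≤ |m * b / a| := by
    rw [abs_div, abs_of_pos (show 0 < t by linarith)]
    exact div_le_self (abs_nonneg _) ht1
  rw [hrw]
  linarith [neg_abs_le (m * b / a / t), le_abs_self (2 * m)]

/-- The isometry acting by `-1` on the hyperbolic plane spanned by `e, f` and trivially on its
orthogonal complement, precomposed with the reflection in a vector of positive norm of that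
plane, is the reflection in a vector of negative norm. -/
lemma anisotropicReflection_mem_of_hyperbolic {B : BilinForm ℚ V}
    (hsymm : ∀ x y, B x y = B y x) (H : Subgroup (V ≃ₗ[ℚ] V)) {e f : V} (hee : B e e = 0)
    (hff : B f f = 0) (hef : B e f = -1)
    (hpos : ∀ u (hu : 0 < B u u), anisotropicReflection B u hu.ne' ∈ H)
    (hneg : ∀ g ∈ isomGroup B,
      (∀ x, g x = x + (2 * B f x) • e + (2 * B e x) • f) → g ∈ H)
    {s t : ℚ} (hst : 0 < s * t) (hw : B (s • e + t • f) (s • e + t • f) ≠ 0) :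
    anisotropicReflection B (s • e + t • f) hw ∈ H := by
  have hfe : B f e = -1 := by rw [hsymm, hef]
  have hs : s ≠ 0 := left_ne_zero_of_mul hst.ne'
  have ht : t ≠ 0 := right_ne_zero_of_mul hst.ne'
  have hv : B (s • e - t • f) (s • e - t • f) = 2 * (s * t) := by
    simp only [map_sub, map_smul, LinearMap.sub_apply, LinearMap.smul_apply, smul_eq_mul, hee,
      hff, hef, hfe]
    ring
  have hw' : B (s • e + t • f) (s • e + t • f) = -(2 * (s * t)) := by
    simp only [map_add, map_smul, LinearMap.add_apply, LinearMap.smul_apply, smul_eq_mul, hee,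
      hff, hef, hfe]
    ring
  have hv0 : 0 < B (s • e - t • f) (s • e - t • f) := by rw [hv]; linarith
  have hmem := hpos _ hv0
  have hprod : anisotropicReflection B (s • e + t • f) hw *
      anisotropicReflection B (s • e - t • f) hv0.ne' ∈ H := by
    refine hneg _ ((isomGroup B).mul_mem (anisotropicReflection_mem_isomGroup hsymm _ _)
      (anisotropicReflection_mem_isomGroup hsymm _ _)) fun x => ?_
    rw [LinearEquiv.mul_apply]
    simp only [anisotropicReflection_apply, hv, hw']
    simp only [map_sub, map_add, map_smul, LinearMap.sub_apply, LinearMap.add_apply,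
      LinearMap.smul_apply, smul_eq_mul, hee, hff, hef, hfe]
    match_scalars <;> field_simp <;> ring
  exact (Subgroup.mul_mem_cancel_right H hmem).mp hprod

/-- A group containing all positive reflections and minus the identity on a hyperbolic plane
contains all negative reflections. -/
lemma anisotropicReflection_mem_of_neg {B : BilinForm ℚ V}
    (hsymm : ∀ x y, B x y = B y x) (H : Subgroup (V ≃ₗ[ℚ] V)) {e f : V} (hee : B e e = 0)
    (hff : B f f = 0) (hef : B e f = -1)
    (hpos : ∀ u (hu : 0 < B u u), anisotropicReflection B u hu.ne' ∈ H)
    (hneg : ∀ g ∈ isomGroup B,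
      (∀ x, g x = x + (2 * B f x) • e + (2 * B e x) • f) → g ∈ H)
    (u : V) (hu : B u u < 0) : anisotropicReflection B u hu.ne ∈ H := by
  have hfe : B f e = -1 := by rw [hsymm, hef]
  have hne : ∀ u (hu : B u u < 0), B u e ≠ 0 → anisotropicReflection B u hu.ne ∈ H := by
    intro u hu hue
    obtain ⟨m, hm⟩ : ∃ m, B u u = -(2 * m) := ⟨-(B u u / 2), by ring⟩
    have hm0 : 0 < m := by linarith
    obtain ⟨s, hs, hlt⟩ := exists_ne_zero_mul_add_div_lt (m := m) (b := B u f) hue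
    have hst : 0 < s * (m / s) := by rwa [mul_div_cancel₀ _ hs]
    set w := s • e + (m / s) • f with hwdef
    have hw : B w w = -(2 * m) := by
      simp only [hwdef, map_add, map_smul, LinearMap.add_apply, LinearMap.smul_apply,
        smul_eq_mul, hee, hff, hef, hfe]
      field_simp
      ring
    have huw : B u w < -(2 * m) := by
      simpa only [hwdef, map_add, map_smul, smul_eq_mul] using hlt
    have hd : 0 < B (u - w) (u - w) := by
      simp only [map_sub, LinearMap.sub_apply, hsymm w u, hm, hw]
      linarith
    have hw0 : B w w ≠ 0 := by rw [hw, ← hm]; exact hu.ne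
    exact anisotropicReflection_mem_of_map H (hpos _ hd)
      (anisotropicReflection_mem_isomGroup hsymm _ _)
      (anisotropicReflection_sub hsymm (hm.trans hw.symm) hd.ne') hu.ne hw0
      (anisotropicReflection_mem_of_hyperbolic hsymm H hee hff hef hpos hneg hst hw0)
  by_cases hue : B u e = 0
  swap
  · exact hne u hu hue
  obtain ⟨c, hc, hcb, hcc⟩ : ∃ c : ℚ, c ≠ 0 ∧ 0 ≤ c * B u f ∧
      0 < B u u - 2 * (c * B u f) + 2 * c ^ 2 := by
    rcases le_total 0 (B u f) with hb | hb
    · refine ⟨1 - B u u + B u f, by linarith, mul_nonneg (by linarith) hb, ?_⟩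
      nlinarith
    · refine ⟨-(1 - B u u - B u f), by linarith, mul_nonneg_of_nonpos_of_nonpos (by linarith) hb,
        ?_⟩
      nlinarith
  set x := u + c • (e - f) with hx
  have hxx : B x x = B u u - 2 * (c * B u f) + 2 * c ^ 2 := by
    simp only [hx, map_add, map_sub, map_smul, LinearMap.add_apply, LinearMap.sub_apply,
      LinearMap.smul_apply, smul_eq_mul, hee, hff, hef, hfe, hsymm e u, hsymm f u, hue]
    ring
  have hxu : B x u = B u u - c * B u f := by
    simp only [hx, map_add, map_sub, map_smul, LinearMap.add_apply, LinearMap.sub_apply,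
      LinearMap.smul_apply, smul_eq_mul, hsymm e u, hsymm f u, hue]
    ring
  have hxe : B x e = c := by
    simp only [hx, map_add, map_sub, map_smul, LinearMap.add_apply, LinearMap.sub_apply,
      LinearMap.smul_apply, smul_eq_mul, hee, hfe, hue]
    ring
  have hx0 : 0 < B x x := hxx ▸ hcc
  have hiso := anisotropicReflection_mem_isomGroup hsymm x hx0.ne'
  have hnorm : B (anisotropicReflection B x hx0.ne' u) (anisotropicReflection B x hx0.ne' u) < 0 :=
    (hiso u u).trans_lt hu
  refine anisotropicReflection_mem_of_map H (hpos x hx0) hiso rfl hu.ne hnorm.ne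
    (hne _ hnorm ?_)
  rw [anisotropicReflection_apply, map_sub, map_smul, LinearMap.sub_apply, LinearMap.smul_apply,
    hue, hxe, smul_eq_mul, zero_sub, neg_ne_zero]
  exact mul_ne_zero (div_ne_zero (mul_ne_zero two_ne_zero (by rw [hxu]; linarith)) hx0.ne') hc

/-- `O(L_ℚ)` is generated by `O(L)` (the isometries of `L_ℚ` preserving the
lattice `L`) together with the reflections `ρ_u` for `u ∈ L` with `(u,u) > 0`. -/
theorem statement3
    {V : Type*} [AddCommGroup V] [Module ℚ V] [FiniteDimensional ℚ V]
    (B : BilinForm ℚ V) (L : Submodule ℤ V)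
    (hsymm : ∀ x y, B x y = B y x)
    (hfull : Submodule.span ℚ (L : Set V) = ⊤)
    (hfg : L.FG)
    (hint : ∀ x ∈ L, ∀ y ∈ L, ∃ n : ℤ, B x y = (n : ℚ))
    (heven : ∀ x ∈ L, ∃ n : ℤ, B x x = 2 * (n : ℚ))
    (hunimod : dualLattice B L = L)
    (sminus : ℕ) (hs : 3 ≤ sminus) (hsig : HasSignatureThree B sminus)
    (hU3 : ContainsU3 B L) :
    Subgroup.closure {g : V ≃ₗ[ℚ] V | g ∈ isomGroup B ∧
        (PreservesLattice L g ∨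
          ∃ u ∈ L, 0 < B u u ∧ ∀ x, g x = x - (2 * B u x / B u u) • u)}
      = isomGroup B := by
  set S : Set (V ≃ₗ[ℚ] V) := {g | g ∈ isomGroup B ∧ (PreservesLattice L g ∨
    ∃ u ∈ L, 0 < B u u ∧ ∀ x, g x = x - (2 * B u x / B u u) • u)} with hS
  refine le_antisymm ((Subgroup.closure_le _).mpr fun g hg => hg.1) ?_
  obtain ⟨e, f, heL, hfL, hee, hff, hef⟩ := hU3
  have hpos : ∀ u (hu : 0 < B u u), anisotropicReflection B u hu.ne' ∈ Subgroup.closure S := by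
    intro u hu
    obtain ⟨n, hn, hnu⟩ := exists_ne_zero_smul_mem_of_span_eq_top hfull u
    have hn' : (n : ℚ) ≠ 0 := Int.cast_ne_zero.mpr hn
    refine Subgroup.subset_closure ⟨anisotropicReflection_mem_isomGroup hsymm u _,
      Or.inr ⟨n • u, hnu, ?_, fun x => ?_⟩⟩
    · rw [← Int.cast_smul_eq_zsmul ℚ n u, map_smul, map_smul, LinearMap.smul_apply, smul_eq_mul,
        smul_eq_mul, ← mul_assoc]
      exact mul_pos (mul_self_pos.mpr hn') hu
    · rw [anisotropicReflection_apply, ← Int.cast_smul_eq_zsmul ℚ n u, map_smul, map_smul,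
        LinearMap.smul_apply, LinearMap.smul_apply, smul_eq_mul, smul_eq_mul, smul_eq_mul,
        smul_smul]
      congr 2
      have := hu.ne'
      field_simp
  have hneg : ∀ g ∈ isomGroup B,
      (∀ x, g x = x + (2 * B (f 0) x) • e 0 + (2 * B (e 0) x) • f 0) →
        g ∈ Subgroup.closure S := by
    intro g hg hgx
    have hmap : ∀ x ∈ L, g x ∈ L := by
      intro x hx
      obtain ⟨m, hm⟩ := hint _ (hfL 0) x hx
      obtain ⟨n, hn⟩ := hint _ (heL 0) x hx
      have hz : g x = x + (2 * m) • e 0 + (2 * n) • f 0 := by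
        rw [hgx, hm, hn, ← Int.cast_smul_eq_zsmul ℚ (2 * m), ← Int.cast_smul_eq_zsmul ℚ (2 * n)]
        push_cast
        rfl
      rw [hz]
      exact L.add_mem (L.add_mem hx (L.smul_mem _ (heL 0))) (L.smul_mem _ (hfL 0))
    have hinv : ∀ x, g.symm x = g x := by
      intro x
      have hef0 : B (e 0) (f 0) = -1 := by simpa using hef 0 0
      rw [LinearEquiv.symm_apply_eq]
      simp only [hgx, map_add, map_smul, smul_eq_mul, hee, hff, hef0, hsymm (f 0) (e 0)]
      module
    exact Subgroup.subset_closure ⟨hg, Or.inl ⟨hmap, fun x hx => hinv x ▸ hmap x hx⟩⟩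
  refine isomGroup_le_of_anisotropicReflection_mem hsymm (hsig.eq_zero_of_forall hsymm) _
    fun u hu => ?_
  rcases hu.lt_or_gt with h | h
  · exact anisotropicReflection_mem_of_neg hsymm _ (hee 0 0) (hff 0 0) (by simpa using hef 0 0)
      hpos hneg u h
  · exact hpos u h
end
end

section
/- Let V₁ and V₂ be finite-dimensional ℚ-vector spaces with nondegenerate symmetric bilinear forms and Mukai extensions Ṽ₁ and Ṽ₂. Let φ̃ : Ṽ₁ → Ṽ₂ be an isometry satisfying φ̃ ∘ h̃₁ = −h̃₂ ∘ φ̃, and let t ∈ ℚ be such that φ̃(β₁) = t·α₂ (such t exists and is nonzero). Then φ̃(α₁) = t⁻¹·β₂, φ̃ maps V₁ onto V₂, and for every λ ∈ V₁ with (λ,λ) ≠ 0, the endomorphism f := (2/(t·(λ,λ))) · φ̃⁻¹ ∘ e_{φ̃(λ)} ∘ φ̃ of Ṽ₁ satisfies the sl₂-triple relations [e_λ, f] = h̃₁, [h̃₁, e_λ] = 2·e_λ, and [h̃₁, f] = −2·f; that is, f is the dual Lefschetz operator e_λ^∨ of the pair (e_λ, h̃₁). -/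
noncomputable section

variable {V : Type*} [AddCommGroup V] [Module ℚ V]

/-- The Mukai extension `Ṽ = ℚα ⊕ V ⊕ ℚβ` of `(V, B)`, modelled as `ℚ × V × ℚ` with
`α = (1,0,0)` and `β = (0,0,1)`: the bilinear form restricts to `B` on `V`, the vectors `α`
and `β` are isotropic and orthogonal to `V`, and `(α,β) = −1`. -/
def mukaiForm (B : LinearMap.BilinForm ℚ V) : LinearMap.BilinForm ℚ (ℚ × V × ℚ) :=
  LinearMap.mk₂ ℚ (fun p q => B p.2.1 q.2.1 - p.1 * q.2.2 - p.2.2 * q.1)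
    (fun p p' q => by
      simp only [Prod.fst_add, Prod.snd_add, map_add, LinearMap.add_apply]
      ring)
    (fun c p q => by
      simp only [Prod.smul_fst, Prod.smul_snd, map_smul, LinearMap.smul_apply, smul_eq_mul]
      ring)
    (fun p q q' => by
      simp only [Prod.fst_add, Prod.snd_add, map_add, LinearMap.add_apply]
      ring)
    (fun p c q => by
      simp only [Prod.smul_fst, Prod.smul_snd, map_smul, LinearMap.smul_apply, smul_eq_mul]
      ring)

/-- The endomorphism `e_λ` of the Mukai extension, sending `α` to `λ`, annihilating `β`,
and sending `μ ∈ V` to `(λ,μ)·β`. -/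
def eOp (B : LinearMap.BilinForm ℚ V) (l : V) : Module.End ℚ (ℚ × V × ℚ) where
  toFun p := ((0 : ℚ), p.1 • l, B l p.2.1)
  map_add' p q := by
    simp only [Prod.fst_add, Prod.snd_add, map_add, add_smul, Prod.mk_add_mk, add_zero]
  map_smul' c p := by
    simp only [Prod.smul_fst, Prod.smul_snd, map_smul, Prod.smul_mk, smul_smul,
      smul_eq_mul, smul_zero, mul_zero, RingHom.id_apply]

/-- The grading operator `h̃` of the Mukai extension: it multiplies `α` by `−2`, `β` by `2`,
and annihilates `V`. -/
def hOp (V : Type*) [AddCommGroup V] [Module ℚ V] : Module.End ℚ (ℚ × V × ℚ) where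
  toFun p := (-2 * p.1, (0 : V), 2 * p.2.2)
  map_add' p q := by
    simp only [Prod.fst_add, Prod.snd_add, Prod.mk_add_mk, mul_add, add_zero]
  map_smul' c p := by
    simp only [Prod.smul_fst, Prod.smul_snd, Prod.smul_mk, smul_eq_mul, smul_zero,
      RingHom.id_apply, mul_left_comm]

theorem mukaiForm_apply (B : LinearMap.BilinForm ℚ V) (p q : ℚ × V × ℚ) :
    mukaiForm B p q = B p.2.1 q.2.1 - p.1 * q.2.2 - p.2.2 * q.1 := rfl

theorem eOp_apply (B : LinearMap.BilinForm ℚ V) (l : V) (p : ℚ × V × ℚ) :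
    eOp B l p = ((0 : ℚ), p.1 • l, B l p.2.1) := rfl

theorem hOp_apply (p : ℚ × V × ℚ) : hOp V p = (-2 * p.1, (0 : V), 2 * p.2.2) := rfl

/-- The operator `e_l` has degree `2` for the grading. -/
theorem hOp_commutator_eOp (B : LinearMap.BilinForm ℚ V) (l : V) :
    hOp V * eOp B l - eOp B l * hOp V = (2 : ℚ) • eOp B l := by
  refine LinearMap.ext fun p => ?_
  ext <;> simp [eOp_apply, hOp_apply, mul_smul]

/-- The dual Lefschetz operator of `e_l` in coordinates: it satisfies the remaining relations of
an `sl₂`-triple. -/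
theorem sl2_relations_of_apply (B : LinearMap.BilinForm ℚ V) {l : V} (hl : B l l ≠ 0)
    (f : Module.End ℚ (ℚ × V × ℚ))
    (hf : ∀ p, f p = (2 / B l l) • (B l p.2.1, p.2.2 • l, (0 : ℚ))) :
    eOp B l * f - f * eOp B l = hOp V ∧ hOp V * f - f * hOp V = (-2 : ℚ) • f := by
  constructor <;> refine LinearMap.ext fun p => ?_
  · ext
    · simp [eOp_apply, hOp_apply, hf]
      field_simp
    · simp [eOp_apply, hOp_apply, hf, smul_smul]
    · simp [eOp_apply, hOp_apply, hf]
      field_simp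
  · ext
    · simp [hOp_apply, hf]
    · simp [hOp_apply, hf, smul_smul]
      module
    · simp [hOp_apply, hf]

section AntiGraded

variable {V₁ : Type*} [AddCommGroup V₁] [Module ℚ V₁]
  {V₂ : Type*} [AddCommGroup V₂] [Module ℚ V₂]
  {φ : (ℚ × V₁ × ℚ) ≃ₗ[ℚ] (ℚ × V₂ × ℚ)}

/-- A map anticommuting with the gradings sends the degree `2` line to the degree `-2` line. -/
theorem exists_map_beta (hanti : ∀ p, φ (hOp V₁ p) = -(hOp V₂ (φ p))) :
    ∃ t : ℚ, φ ((0 : ℚ), (0 : V₁), (1 : ℚ)) = (t, (0 : V₂), (0 : ℚ)) := by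
  have h := hanti ((0 : ℚ), (0 : V₁), (1 : ℚ))
  have e : hOp V₁ ((0 : ℚ), (0 : V₁), (1 : ℚ)) = (2 : ℚ) • ((0 : ℚ), (0 : V₁), (1 : ℚ)) := by
    simp [hOp_apply]
  rw [e, map_smul, hOp_apply] at h
  generalize φ ((0 : ℚ), (0 : V₁), (1 : ℚ)) = q at h ⊢
  obtain ⟨x, y, z⟩ := q
  simp only [Prod.smul_mk, Prod.neg_mk, Prod.mk.injEq, smul_eq_mul, neg_zero,
    smul_eq_zero] at h
  obtain ⟨-, hy, hz⟩ := h
  refine ⟨x, ?_⟩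
  rw [hy.resolve_left two_ne_zero, show z = 0 by linarith]

/-- A map anticommuting with the gradings sends the degree `-2` line to the degree `2` line. -/
theorem exists_map_alpha (hanti : ∀ p, φ (hOp V₁ p) = -(hOp V₂ (φ p))) :
    ∃ s : ℚ, φ ((1 : ℚ), (0 : V₁), (0 : ℚ)) = ((0 : ℚ), (0 : V₂), s) := by
  have h := hanti ((1 : ℚ), (0 : V₁), (0 : ℚ))
  have e : hOp V₁ ((1 : ℚ), (0 : V₁), (0 : ℚ)) = (-2 : ℚ) • ((1 : ℚ), (0 : V₁), (0 : ℚ)) := by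
    simp [hOp_apply]
  rw [e, map_smul, hOp_apply] at h
  generalize φ ((1 : ℚ), (0 : V₁), (0 : ℚ)) = q at h ⊢
  obtain ⟨x, y, z⟩ := q
  simp only [Prod.smul_mk, Prod.neg_mk, Prod.mk.injEq, smul_eq_mul, neg_zero,
    smul_eq_zero] at h
  obtain ⟨hx, hy, -⟩ := h
  refine ⟨z, ?_⟩
  rw [hy.resolve_left (by norm_num), show x = 0 by linarith]

/-- A map anticommuting with the gradings preserves the degree `0` part. -/
theorem map_degree_zero (hanti : ∀ p, φ (hOp V₁ p) = -(hOp V₂ (φ p))) (v : V₁) :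
    φ ((0 : ℚ), v, (0 : ℚ)) = ((0 : ℚ), (φ ((0 : ℚ), v, (0 : ℚ))).2.1, (0 : ℚ)) := by
  have h := hanti ((0 : ℚ), v, (0 : ℚ))
  have e : hOp V₁ ((0 : ℚ), v, (0 : ℚ)) = 0 := by
    simp [hOp_apply]
  rw [e, map_zero, hOp_apply] at h
  generalize φ ((0 : ℚ), v, (0 : ℚ)) = q at h ⊢
  obtain ⟨x, y, z⟩ := q
  simpa [Prod.ext_iff, eq_comm] using h

/-- An anti-graded map in coordinates. -/
theorem map_eq_of_anti (hanti : ∀ p, φ (hOp V₁ p) = -(hOp V₂ (φ p))) {s t : ℚ}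
    (hα : φ ((1 : ℚ), (0 : V₁), (0 : ℚ)) = ((0 : ℚ), (0 : V₂), s))
    (hβ : φ ((0 : ℚ), (0 : V₁), (1 : ℚ)) = (t, (0 : V₂), (0 : ℚ))) (p : ℚ × V₁ × ℚ) :
    φ p = (t * p.2.2, (φ ((0 : ℚ), p.2.1, (0 : ℚ))).2.1, s * p.1) := by
  obtain ⟨a, v, b⟩ := p
  have e : ((a, v, b) : ℚ × V₁ × ℚ) = a • ((1 : ℚ), (0 : V₁), (0 : ℚ)) +
      (((0 : ℚ), v, (0 : ℚ)) + b • ((0 : ℚ), (0 : V₁), (1 : ℚ))) := by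
    simp
  rw [e, map_add, map_add, map_smul, map_smul, hα, hβ, map_degree_zero hanti v]
  simp [mul_comm]

/-- For an anti-graded isometry, the scalars on the two extremal lines are inverse. -/
theorem mul_eq_one_of_isometry {B₁ : LinearMap.BilinForm ℚ V₁} {B₂ : LinearMap.BilinForm ℚ V₂}
    (hiso : ∀ p q, mukaiForm B₂ (φ p) (φ q) = mukaiForm B₁ p q) {s t : ℚ}
    (hα : φ ((1 : ℚ), (0 : V₁), (0 : ℚ)) = ((0 : ℚ), (0 : V₂), s))
    (hβ : φ ((0 : ℚ), (0 : V₁), (1 : ℚ)) = (t, (0 : V₂), (0 : ℚ))) : s * t = 1 := by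
  have h := hiso ((1 : ℚ), (0 : V₁), (0 : ℚ)) ((0 : ℚ), (0 : V₁), (1 : ℚ))
  rw [hα, hβ] at h
  simpa [mukaiForm_apply] using h

/-- Conjugating `e_{φ(l)}` by an anti-graded isometry `φ` gives a multiple of the dual Lefschetz
operator. -/
theorem symm_eOp_map {B₁ : LinearMap.BilinForm ℚ V₁} {B₂ : LinearMap.BilinForm ℚ V₂}
    (hiso : ∀ p q, mukaiForm B₂ (φ p) (φ q) = mukaiForm B₁ p q)
    (hanti : ∀ p, φ (hOp V₁ p) = -(hOp V₂ (φ p))) {s t : ℚ}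
    (hα : φ ((1 : ℚ), (0 : V₁), (0 : ℚ)) = ((0 : ℚ), (0 : V₂), s))
    (hβ : φ ((0 : ℚ), (0 : V₁), (1 : ℚ)) = (t, (0 : V₂), (0 : ℚ))) (l : V₁)
    (p : ℚ × V₁ × ℚ) :
    φ.symm (eOp B₂ (φ ((0 : ℚ), l, (0 : ℚ))).2.1 (φ p)) =
      t • (B₁ l p.2.1, p.2.2 • l, (0 : ℚ)) := by
  have hst := mul_eq_one_of_isometry hiso hα hβ
  have hB : B₂ (φ ((0 : ℚ), l, (0 : ℚ))).2.1 (φ ((0 : ℚ), p.2.1, (0 : ℚ))).2.1 =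
      B₁ l p.2.1 := by
    have h := hiso ((0 : ℚ), l, (0 : ℚ)) ((0 : ℚ), p.2.1, (0 : ℚ))
    rw [map_degree_zero hanti l, map_degree_zero hanti p.2.1] at h
    simpa [mukaiForm_apply] using h
  have hl : φ ((0 : ℚ), p.2.2 • l, (0 : ℚ)) = p.2.2 • φ ((0 : ℚ), l, (0 : ℚ)) := by
    rw [← map_smul]
    simp
  rw [LinearEquiv.symm_apply_eq, map_smul, map_eq_of_anti hanti hα hβ p,
    map_eq_of_anti hanti hα hβ (B₁ l p.2.1, p.2.2 • l, (0 : ℚ)), eOp_apply]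
  simp only [hB, hl, Prod.smul_mk, Prod.smul_fst, Prod.smul_snd, smul_smul, smul_eq_mul]
  ext
  · simp
  · simp
  · linear_combination (-B₁ l p.2.1) * hst

end AntiGraded

/-- Let `φ̃ : Ṽ₁ → Ṽ₂` be an isometry of Mukai extensions with
`φ̃ ∘ h̃₁ = −h̃₂ ∘ φ̃`, and let `t ∈ ℚ` satisfy `φ̃(β₁) = t·α₂` (such `t` exists and is
nonzero). Then `φ̃(α₁) = t⁻¹·β₂`, `φ̃` maps `V₁` onto `V₂`, and for every `λ ∈ V₁` with
`(λ,λ) ≠ 0` the endomorphism `f = (2/(t·(λ,λ))) · φ̃⁻¹ ∘ e_{φ̃(λ)} ∘ φ̃` of `Ṽ₁` satisfies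
`[e_λ, f] = h̃₁`, `[h̃₁, e_λ] = 2·e_λ` and `[h̃₁, f] = −2·f`; that is, `f` is the dual
Lefschetz operator `e_λ^∨` of the pair `(e_λ, h̃₁)`. -/
theorem statement8
    {V₁ : Type*} [AddCommGroup V₁] [Module ℚ V₁] [FiniteDimensional ℚ V₁]
    {V₂ : Type*} [AddCommGroup V₂] [Module ℚ V₂] [FiniteDimensional ℚ V₂]
    (B₁ : LinearMap.BilinForm ℚ V₁) (B₂ : LinearMap.BilinForm ℚ V₂)
    (h₁symm : ∀ x y, B₁ x y = B₁ y x) (h₂symm : ∀ x y, B₂ x y = B₂ y x)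
    (h₁nd : ∀ x, (∀ y, B₁ x y = 0) → x = 0) (h₂nd : ∀ x, (∀ y, B₂ x y = 0) → x = 0)
    (φ : (ℚ × V₁ × ℚ) ≃ₗ[ℚ] (ℚ × V₂ × ℚ))
    (hiso : ∀ p q, mukaiForm B₂ (φ p) (φ q) = mukaiForm B₁ p q)
    (hanti : ∀ p, φ (hOp V₁ p) = -(hOp V₂ (φ p))) :
    (∃ t : ℚ, t ≠ 0 ∧ φ ((0 : ℚ), (0 : V₁), (1 : ℚ)) = ((t : ℚ), (0 : V₂), (0 : ℚ))) ∧
    ∀ t : ℚ, φ ((0 : ℚ), (0 : V₁), (1 : ℚ)) = ((t : ℚ), (0 : V₂), (0 : ℚ)) →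
      t ≠ 0 ∧
      φ ((1 : ℚ), (0 : V₁), (0 : ℚ)) = ((0 : ℚ), (0 : V₂), t⁻¹) ∧
      (∀ v : V₁, ∃ w : V₂, φ ((0 : ℚ), v, (0 : ℚ)) = ((0 : ℚ), w, (0 : ℚ))) ∧
      (∀ w : V₂, ∃ v : V₁, φ ((0 : ℚ), v, (0 : ℚ)) = ((0 : ℚ), w, (0 : ℚ))) ∧
      ∀ l : V₁, B₁ l l ≠ 0 →
        ∀ f : Module.End ℚ (ℚ × V₁ × ℚ),
          f = (2 / (t * B₁ l l)) •
            (φ.symm.toLinearMap ∘ₗ eOp B₂ ((φ ((0 : ℚ), l, (0 : ℚ))).2.1) ∘ₗ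
              φ.toLinearMap) →
          eOp B₁ l * f - f * eOp B₁ l = hOp V₁ ∧
          hOp V₁ * eOp B₁ l - eOp B₁ l * hOp V₁ = (2 : ℚ) • eOp B₁ l ∧
          hOp V₁ * f - f * hOp V₁ = (-2 : ℚ) • f := by
  obtain ⟨s, hα⟩ := exists_map_alpha hanti
  refine ⟨?_, fun t hβ => ?_⟩
  · obtain ⟨t, hβ⟩ := exists_map_beta hanti
    exact ⟨t, right_ne_zero_of_mul_eq_one (mul_eq_one_of_isometry hiso hα hβ), hβ⟩
  have hst := mul_eq_one_of_isometry hiso hα hβ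
  have ht : t ≠ 0 := right_ne_zero_of_mul_eq_one hst
  refine ⟨ht, ?_, fun v => ⟨_, map_degree_zero hanti v⟩, fun w => ?_, ?_⟩
  · rw [hα, eq_inv_of_mul_eq_one_left hst]
  · refine ⟨(φ.symm ((0 : ℚ), w, (0 : ℚ))).2.1, ?_⟩
    have h := map_eq_of_anti hanti hα hβ (φ.symm ((0 : ℚ), w, (0 : ℚ)))
    rw [LinearEquiv.apply_symm_apply] at h
    rw [map_degree_zero hanti, ← congrArg (fun q => q.2.1) h]
  · rintro l hl f rfl
    have hf := sl2_relations_of_apply B₁ hl ((2 / (t * B₁ l l)) •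
        (φ.symm.toLinearMap ∘ₗ eOp B₂ ((φ ((0 : ℚ), l, (0 : ℚ))).2.1) ∘ₗ φ.toLinearMap))
      fun p => by
        simp only [LinearMap.smul_apply, LinearMap.comp_apply, LinearEquiv.coe_coe]
        rw [symm_eOp_map hiso hanti hα hβ, smul_smul]
        congr 1
        field_simp
    exact ⟨hf.1, hOp_commutator_eOp B₁ l, hf.2⟩
end
end
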